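/- Consider Algorithm 1 with the permutation π and the edge sample L fixed, so that Z_{v,1} is a function Z_{v,1}(x⃗) of the indicator vector x⃗ ∈ {0,1}^V of the part V_1. For any vector x⃗, any vertex w, and any vector x⃗^(w) obtained from x⃗ by changing the coordinate of w, it holds that (Z_{v,1}(x⃗) − Z_{v,1}(x⃗^(w)))² ≤ 4. -/

import Mathlib

open Finset
open scoped Classical

section Defs

private lemma sym2_exists_mem {V : Type*} (e : Sym2 V) : ∃ a, a ∈ e :=
  ⟨(Quot.out e).1, Sym2.out_fst_mem e⟩

variable {V : Type*} [Fintype V] [DecidableEq V]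

/-- The greedy maximal matching of the graph with edge set `E`, processing edges in
increasing order of the priority function `ρ`: repeatedly pick the minimum-priority
remaining edge, add it to the matching, and discard all edges meeting it. -/
noncomputable def greedyMM {β : Type*} [LinearOrder β] (ρ : Sym2 V → β) (E : Finset (Sym2 V)) :
    Finset (Sym2 V) :=
  if h : E.Nonempty then
    insert (Classical.choose (E.exists_min_image ρ h))
      (greedyMM ρ (E.filter fun f =>
        ¬ ∃ v, v ∈ Classical.choose (E.exists_min_image ρ h) ∧ v ∈ f))
  else ∅
termination_by E.card
decreasing_by
  have he : Classical.choose (E.exists_min_image ρ h) ∈ E :=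
    (Classical.choose_spec (E.exists_min_image ρ h)).1
  apply Finset.card_lt_card
  refine (Finset.ssubset_iff_of_subset (Finset.filter_subset _ _)).2 ⟨_, he, ?_⟩
  intro hmem
  obtain ⟨a, ha⟩ := sym2_exists_mem (Classical.choose (E.exists_min_image ρ h))
  exact (Finset.mem_filter.1 hmem).2 ⟨a, ha, ha⟩

/-- The set of vertices matched by a set `M` of edges. -/
noncomputable def matchedV (M : Finset (Sym2 V)) : Finset V :=
  Finset.univ.filter fun v => ∃ e ∈ M, v ∈ e

/-- Residual degree of `v` with respect to the matching `M` in the graph with edge set `E`: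
`0` if `v` is matched, and otherwise the degree of `v` in the induced subgraph on
unmatched vertices. -/
noncomputable def resDeg (E M : Finset (Sym2 V)) (v : V) : ℕ :=
  if v ∈ matchedV M then 0
  else (E.filter fun e => v ∈ e ∧ ∀ w ∈ e, w ∉ matchedV M).card

/-- The number of vertices whose match-status differs between `M` and `M'`. -/
noncomputable def statusDiff (M M' : Finset (Sym2 V)) : ℕ :=
  (Finset.univ.filter fun v => ¬ (v ∈ matchedV M ↔ v ∈ matchedV M')).card


/-- The endpoints of an edge, as a finset. -/
noncomputable def ends (e : Sym2 V) : Finset V := Finset.univ.filter (· ∈ e)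

/-- The recursive edge oracle (with bookkeeping), for the graph with (sampled) edge set `L`
and priorities `π`, run with the partition-indicator vector `x`.
`eoQ π L x fuel e` returns a triple `(ans, qs, cnt)` where `ans` tells whether `e` joins the
greedy matching of the induced subgraph of `L` on `{v | x v}`, `qs` is the set of entries of
`x` queried, and `cnt` is the number of (recursive) oracle calls made on edges of `L` having
both endpoints in `{v | x v}` (including the call on `e` itself, when applicable).
The oracle first queries the two endpoints of `e` and answers NO if one of them is outside
the part; otherwise it recursively evaluates the incident edges of `L` of smaller priority,
in increasing order of priority, stopping as soon as one of them answers YES.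
It is always invoked with `fuel = π e + 1`, which guarantees the fuel never runs out. -/
noncomputable def eoQ (π : Sym2 V → ℕ) (L : Finset (Sym2 V)) (x : V → Bool) :
    ℕ → Sym2 V → Bool × Finset V × ℕ
  | 0, e => (false, ends e, 0)
  | fuel + 1, e =>
    if ∀ v ∈ e, x v then
      let nbrs := ((L.filter fun f => f ≠ e ∧ (∃ v, v ∈ e ∧ v ∈ f) ∧ π f < π e).toList.mergeSort
          (fun a b => decide (π a ≤ π b)))
      let r := nbrs.foldl (fun (s : Bool × Finset V × ℕ) f =>
          if s.1 then s
          else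
            let t := eoQ π L x fuel f
            (t.1, s.2.1 ∪ t.2.1, s.2.2 + t.2.2)) (false, ∅, 0)
      (!r.1, ends e ∪ r.2.1, (if e ∈ L then 1 else 0) + r.2.2)
    else (false, ends e, 0)

/-- Whether `e` belongs to the greedy matching, as decided by the edge oracle. -/
noncomputable def edgeOracle (π : Sym2 V → ℕ) (L : Finset (Sym2 V)) (x : V → Bool)
    (e : Sym2 V) : Bool × Finset V × ℕ :=
  eoQ π L x (π e + 1) e

/-- The degree oracle for vertex `v`: determines `Z_{v,1}`, the number of neighbors of `v`
(in the graph with edge set `Ed`) lying in the part `{u | x u}` that are unmatched in the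
greedy matching of the induced subgraph of `L`.  For each neighbor `u` of `v` it queries
`x u`, and if `x u = 1`, it runs the edge oracle on every edge of `L` incident to `u`.
Returns `(Z value, set of entries of x queried, number of oracle calls on edges inside the part)`. -/
noncomputable def degOr (Ed : Finset (Sym2 V)) (π : Sym2 V → ℕ) (L : Finset (Sym2 V))
    (x : V → Bool) (v : V) : ℕ × Finset V × ℕ :=
  let Nv := Finset.univ.filter fun u => s(u, v) ∈ Ed
  let q := Nv ∪ (Nv.filter fun u => x u).biUnion fun u =>
      (Finset.univ.filter fun w => s(u, w) ∈ L).biUnion fun w =>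
        (edgeOracle π L x s(u, w)).2.1
  let c := ∑ u ∈ Nv.filter (fun u => x u), ∑ w ∈ Finset.univ.filter (fun w => s(u, w) ∈ L),
        (edgeOracle π L x s(u, w)).2.2
  ((Nv.filter fun u => x u ∧ ∀ w ∈ Finset.univ.filter (fun w => s(u, w) ∈ L),
      (edgeOracle π L x s(u, w)).1 = false).card, q, c)

/-- `B v`: the number of entries of `x` queried during the execution of the degree oracle. -/
noncomputable def Bqueries (Ed : Finset (Sym2 V)) (π : Sym2 V → ℕ) (L : Finset (Sym2 V))
    (x : V → Bool) (v : V) : ℕ :=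
  (degOr Ed π L x v).2.1.card

/-- The priority function on edges induced by a permutation `τ` of `Fin E.card`,
via the canonical enumeration of `E`; edges outside `E` get priority `0`. -/
noncomputable def prioOf (E : Finset (Sym2 V)) (τ : Equiv.Perm (Fin E.card)) (e : Sym2 V) : ℕ :=
  if h : e ∈ E then (τ (E.equivFin ⟨e, h⟩) : ℕ) else 0

/-- `L₁`: the set of edges of `L` with both endpoints inside the part `{v | x v}`. -/
noncomputable def partEdges (L : Finset (Sym2 V)) (x : V → Bool) : Finset (Sym2 V) :=
  L.filter fun e => ∀ v ∈ e, x v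

/-- `Z_{v,1}(x)`: the number of neighbors of `v` in the graph `Ed` lying in the part
`{u | x u}` that are unmatched in `M₁ = GreedyMM(L₁, π)`. -/
noncomputable def Zv1 (Ed : Finset (Sym2 V)) (π : Sym2 V → ℕ) (L : Finset (Sym2 V))
    (x : V → Bool) (v : V) : ℕ :=
  (Finset.univ.filter fun u =>
    s(u, v) ∈ Ed ∧ x u ∧ u ∉ matchedV (greedyMM π (partEdges L x))).card


/-- The matching output by Algorithm 1: the union over all parts `i ∈ [k]` of the greedy
maximal matching (w.r.t. the priorities `π`) of the induced subgraph of the sampled edge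
set `L` on the part `V_i = χ⁻¹(i)`. -/
noncomputable def algoMatching (π : Sym2 V → ℕ) (k : ℕ) (χ : V → Fin k)
    (L : Finset (Sym2 V)) : Finset (Sym2 V) :=
  (Finset.univ : Finset (Fin k)).biUnion fun i =>
    greedyMM π (L.filter fun e => ∀ w ∈ e, χ w = i)

/-- `Z_{v,i}`: the number of neighbors of `v` in the graph `Ed` that lie in part `V_i`
and are unmatched in the matching `M` output by Algorithm 1. -/
noncomputable def Zvi (Ed : Finset (Sym2 V)) (π : Sym2 V → ℕ) (k : ℕ) (χ : V → Fin k)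
    (L : Finset (Sym2 V)) (v : V) (i : Fin k) : ℕ :=
  (Finset.univ.filter fun u =>
    s(u, v) ∈ Ed ∧ χ u = i ∧ u ∉ matchedV (algoMatching π k χ L)).card

/-- `Z'_v`: equal to `Z_{v, χ(v)}` if `v` is unmatched in the output `M` of Algorithm 1,
and `0` if `v` is matched in `M`. -/
noncomputable def Zself (Ed : Finset (Sym2 V)) (π : Sym2 V → ℕ) (k : ℕ) (χ : V → Fin k)
    (L : Finset (Sym2 V)) (v : V) : ℕ :=
  if v ∈ matchedV (algoMatching π k χ L) then 0 else Zvi Ed π k χ L v (χ v)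

/-- The Bernoulli product weight of the edge sample `S ⊆ Ed`, each edge kept with
probability `p`. -/
noncomputable def bwE (p : ℝ) (Ed S : Finset (Sym2 V)) : ℝ :=
  p ^ S.card * (1 - p) ^ (Ed.card - S.card)

/-- The Bernoulli product weight of the indicator vector `x : V → Bool`, each coordinate
equal to `true` independently with probability `q`. -/
noncomputable def bwX (q : ℝ) (x : V → Bool) : ℝ :=
  q ^ (Finset.univ.filter fun v => x v = true).card *
    (1 - q) ^ (Finset.univ.filter fun v => x v = false).card

end Defs

/-- One step of the greedy matching, for a priority function with a unique minimizer. -/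
lemma greedyMM_eq_insert {V β : Type*} [Fintype V] [DecidableEq V] [LinearOrder β]
    {ρ : Sym2 V → β} {F : Finset (Sym2 V)} (hρ : Set.InjOn ρ ↑F) {e : Sym2 V} (he : e ∈ F)
    (hmin : ∀ f ∈ F, ρ e ≤ ρ f) :
    greedyMM ρ F = insert e (greedyMM ρ (F.filter fun f => ¬ ∃ v, v ∈ e ∧ v ∈ f)) := by
  have hne : F.Nonempty := ⟨e, he⟩
  have hspec := Classical.choose_spec (F.exists_min_image ρ hne)
  have heq : Classical.choose (F.exists_min_image ρ hne) = e :=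
    hρ hspec.1 he (le_antisymm (hspec.2 e he) (hmin _ hspec.1))
  rw [greedyMM, dif_pos hne, heq]

lemma mem_matchedV_insert {V : Type*} [Fintype V] [DecidableEq V] (e : Sym2 V)
    (M : Finset (Sym2 V)) (u : V) : u ∈ matchedV (insert e M) ↔ u ∈ e ∨ u ∈ matchedV M := by
  simp [matchedV]

/-- Deleting all edges at a vertex `w` changes the match status of no vertex if `w` was
unmatched, and of at most one vertex other than `w` in general. -/
lemma matchedV_greedyMM_delete_vertex {V β : Type*} [Fintype V] [DecidableEq V] [LinearOrder β]
    (ρ : Sym2 V → β) (F : Finset (Sym2 V)) (hρ : Set.InjOn ρ ↑F) (w : V) :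
    (w ∉ matchedV (greedyMM ρ F) → ∀ u,
      u ∈ matchedV (greedyMM ρ F) ↔ u ∈ matchedV (greedyMM ρ (F.filter fun e => w ∉ e))) ∧
    ∃ b, ∀ u, u ≠ w → u ≠ b →
      (u ∈ matchedV (greedyMM ρ F) ↔ u ∈ matchedV (greedyMM ρ (F.filter fun e => w ∉ e))) := by
  induction F using Finset.strongInduction generalizing w with
  | H F ih =>
    rcases F.eq_empty_or_nonempty with rfl | hne
    · exact ⟨fun _ _ => by simp, w, fun _ _ _ => by simp⟩
    obtain ⟨e, he, hmin⟩ := F.exists_min_image ρ hne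
    have hstep := greedyMM_eq_insert hρ he hmin
    by_cases hw : w ∈ e
    · obtain ⟨a, rfl⟩ := Sym2.mem_iff_exists.1 hw
      have hlt : (F.filter fun e => w ∉ e) ⊂ F :=
        Finset.filter_ssubset.2 ⟨_, he, fun h => h hw⟩
      have hrest : (F.filter fun f => ¬ ∃ v, v ∈ s(w, a) ∧ v ∈ f) =
          (F.filter fun e => w ∉ e).filter fun e => a ∉ e := by
        ext f
        simp [and_assoc]
      obtain ⟨h0, b, hb⟩ := ih _ hlt (hρ.mono (Finset.coe_subset.2 hlt.subset)) a
      rw [hstep, hrest]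
      simp only [mem_matchedV_insert, Sym2.mem_iff]
      refine ⟨fun h => (h (by simp)).elim, ?_⟩
      by_cases ha : a ∈ matchedV (greedyMM ρ (F.filter fun e => w ∉ e))
      · refine ⟨b, fun u huw hub => ?_⟩
        by_cases hua : u = a
        · subst hua
          simp [ha]
        · simp [huw, hua, hb u hua hub]
      · exact ⟨a, fun u huw hua => by simp [huw, hua, h0 ha u]⟩
    · have he' : e ∈ F.filter fun e => w ∉ e := Finset.mem_filter.2 ⟨he, hw⟩
      have hstep' := greedyMM_eq_insert
        (hρ.mono (Finset.coe_subset.2 (Finset.filter_subset (fun e => w ∉ e) F))) he'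
        fun f hf => hmin f (Finset.mem_filter.1 hf).1
      have hlt : (F.filter fun f => ¬ ∃ v, v ∈ e ∧ v ∈ f) ⊂ F :=
        Finset.filter_ssubset.2
          ⟨_, he, fun h => h ⟨_, Sym2.out_fst_mem _, Sym2.out_fst_mem _⟩⟩
      obtain ⟨h0, b, hb⟩ := ih _ hlt (hρ.mono (Finset.coe_subset.2 hlt.subset)) w
      rw [Finset.filter_comm] at hstep'
      rw [hstep, hstep']
      simp only [mem_matchedV_insert]
      exact ⟨fun h u => or_congr_right (h0 (fun hm => h (Or.inr hm)) u),
        b, fun u huw hub => or_congr_right (hb u huw hub)⟩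

/-- Removing `w` from the part changes `Zv1` by at most two. -/
lemma Zv1_le_add_two_of_remove {V : Type*} [Fintype V] [DecidableEq V]
    (E : Finset (Sym2 V)) (π : Sym2 V → ℕ) (L : Finset (Sym2 V)) (hπ : Set.InjOn π ↑L)
    (v : V) (x x' : V → Bool) (w : V) (hxx' : ∀ u, u ≠ w → x u = x' u)
    (hw' : x' w = false) :
    Zv1 E π L x v ≤ Zv1 E π L x' v + 2 ∧ Zv1 E π L x' v ≤ Zv1 E π L x v + 2 := by
  have hpart : partEdges L x' = (partEdges L x).filter fun e => w ∉ e := by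
    ext e
    simp only [partEdges, Finset.mem_filter, and_assoc]
    refine and_congr_right fun _ => ⟨fun h => ?_, fun h u hu => ?_⟩
    · have hwe : w ∉ e := fun hm => by simpa [hw'] using h w hm
      exact ⟨fun u hu => by rw [hxx' u (fun huw => hwe (huw ▸ hu))]; exact h u hu, hwe⟩
    · rw [← hxx' u (fun huw => h.2 (huw ▸ hu))]
      exact h.1 u hu
  obtain ⟨-, b, hb⟩ := matchedV_greedyMM_delete_vertex π (partEdges L x)
    (hπ.mono (Finset.coe_subset.2 (Finset.filter_subset _ _))) w
  rw [← hpart] at hb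
  have key : ∀ S T : Finset V, (∀ u ∈ S, u ≠ w → u ≠ b → u ∈ T) → S.card ≤ T.card + 2 := by
    intro S T h
    have hsub : S ⊆ T ∪ {w, b} := by
      intro u hu
      have := h u hu
      simp only [Finset.mem_union, Finset.mem_insert, Finset.mem_singleton]
      tauto
    exact (Finset.card_le_card hsub).trans
      ((Finset.card_union_le _ _).trans (Nat.add_le_add_left Finset.card_le_two _))
  constructor <;> refine key _ _ fun u hu huw hub => ?_
  · simpa [hxx' u huw, hb u huw hub] using hu
  · simpa [hxx' u huw, hb u huw hub] using hu

/-- **Lipschitz property of `Z_{v,1}`** (Claim 4.3).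
Run Algorithm 1 on a graph `G = (V, E)` with maximum degree `Δ`, with the permutation `π`
and the edge sample `L` fixed, so that `Z_{v,1}` is a function `Z_{v,1}(x⃗)` of the
indicator vector `x⃗ ∈ {0,1}^V` of the part `V₁`.  For any vector `x⃗`, any vertex `w`, and
any vector `x⃗⁽ʷ⁾` obtained from `x⃗` by changing the coordinate of `w`, it holds that
`(Z_{v,1}(x⃗) − Z_{v,1}(x⃗⁽ʷ⁾))² ≤ 4`. -/
theorem Zv1_lipschitz
    {V : Type*} [Fintype V] [DecidableEq V]
    (E : Finset (Sym2 V)) (hE : ∀ e ∈ E, ¬ e.IsDiag)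
    (Δ : ℕ) (hdeg : ∀ v : V, (E.filter fun e => v ∈ e).card ≤ Δ) (hΔ : 1 ≤ Δ)
    (π : Sym2 V → ℕ) (hπ : Set.InjOn π ↑E)
    (L : Finset (Sym2 V)) (hL : L ⊆ E)
    (v : V) (x x' : V → Bool) (w : V) (hxx' : ∀ u, u ≠ w → x u = x' u) :
    ((Zv1 E π L x v : ℝ) - (Zv1 E π L x' v : ℝ)) ^ 2 ≤ 4 := by
  have hπL : Set.InjOn π ↑L := hπ.mono (Finset.coe_subset.2 hL)
  have key : Zv1 E π L x v ≤ Zv1 E π L x' v + 2 ∧ Zv1 E π L x' v ≤ Zv1 E π L x v + 2 := by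
    by_cases hw : x w = x' w
    · obtain rfl : x = x' := funext fun u => by
        by_cases hu : u = w
        · rw [hu, hw]
        · exact hxx' u hu
      omega
    cases hx : x w
    · exact (Zv1_le_add_two_of_remove E π L hπL v x' x w (fun u hu => (hxx' u hu).symm) hx).symm
    · exact Zv1_le_add_two_of_remove E π L hπL v x x' w hxx' (by simpa [hx] using hw)
  have h1 : (Zv1 E π L x v : ℝ) ≤ Zv1 E π L x' v + 2 := by exact_mod_cast key.1
  have h2 : (Zv1 E π L x' v : ℝ) ≤ Zv1 E π L x v + 2 := by exact_mod_cast key.2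
  nlinarith
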